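/- Say a mechanism x is ex-post incentive compatible if x(s,y)·(s·∏_{k=1}^{n−1} y_k − (1−s)·∏(1−y_k)) ≥ x(t,y)·(s·∏_{k=1}^{n−1} y_k − (1−s)·∏(1−y_k)) for all s, t ∈ [0,1] and all y ∈ [0,1]^(n−1), and that x satisfies participation if U_x(s;s) ≥ 0 for all s ∈ [0,1]. Let x_eff(s,y) = 1{s·∏_{k=1}^{n−1} y_k ≥ (1−s)·∏(1−y_k)}. Then: x_eff is ex-post incentive compatible and satisfies participation; every mechanism x that is ex-post incentive compatible and satisfies participation has V(x) ≤ V(x_eff); and if moreover V(x) = V(x_eff), then x = x_eff Lebesgue-almost everywhere on [0,1]^n. -/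

import Mathlib

open MeasureTheory Set Filter

noncomputable section

/-- The unit cube `[0,1]^m` inside `Fin m → ℝ`. -/
def cube (m : ℕ) : Set (Fin m → ℝ) := Set.univ.pi fun _ => Set.Icc (0:ℝ) 1

/-- `w⁺(y) = ∏ y_k · f(y_k)`. -/
def wplus (f : ℝ → ℝ) {m : ℕ} (y : Fin m → ℝ) : ℝ := ∏ k, y k * f (y k)

/-- `w⁻(y) = ∏ (1 - y_k) · f(y_k)`. -/
def wminus (f : ℝ → ℝ) {m : ℕ} (y : Fin m → ℝ) : ℝ := ∏ k, (1 - y k) * f (y k)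

/-- Hypotheses on the signal density `f` with derivative `f'` on `[L,R]`. -/
structure Density (f f' : ℝ → ℝ) (L R : ℝ) : Prop where
  nonneg : ∀ s, 0 ≤ f s
  zero_outside : ∀ s ∉ Set.Icc L R, f s = 0
  pos : ∀ s ∈ Set.Icc L R, 0 < f s
  hderiv : ∀ s ∈ Set.Icc L R, HasDerivWithinAt f (f' s) (Set.Icc L R) s
  cont_deriv : ContinuousOn f' (Set.Icc L R)
  total : (∫ s in L..R, f s) = 1
  mean : (∫ s in L..R, s * f s) = 1 / 2

/-- A mechanism is measurable with values in `[0,1]`. -/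
def IsMechanism {m : ℕ} (x : ℝ → (Fin m → ℝ) → ℝ) : Prop :=
  Measurable (Function.uncurry x) ∧ ∀ s y, x s y ∈ Set.Icc (0:ℝ) 1

/-- `A(t) = ∫_{[0,1]^m} x(t,y) w⁺(y) dy`. -/
def Amap (f : ℝ → ℝ) {m : ℕ} (x : ℝ → (Fin m → ℝ) → ℝ) (t : ℝ) : ℝ :=
  ∫ y in cube m, x t y * wplus f y

/-- `B(t) = ∫_{[0,1]^m} x(t,y) w⁻(y) dy`. -/
def Bmap (f : ℝ → ℝ) {m : ℕ} (x : ℝ → (Fin m → ℝ) → ℝ) (t : ℝ) : ℝ :=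
  ∫ y in cube m, x t y * wminus f y

/-- Interim payoff `U_x(t;s) = 2^m (s A(t) - (1-s) B(t))` (with `m = n-1`). -/
def Upay (f : ℝ → ℝ) {m : ℕ} (x : ℝ → (Fin m → ℝ) → ℝ) (t s : ℝ) : ℝ :=
  2 ^ m * (s * Amap f x t - (1 - s) * Bmap f x t)

/-- Feasibility: mechanism + participation + incentive compatibility on `[L,R]`. -/
def Feasible (f : ℝ → ℝ) (L R : ℝ) {m : ℕ} (x : ℝ → (Fin m → ℝ) → ℝ) : Prop :=
  IsMechanism x ∧ (∀ s ∈ Set.Icc L R, 0 ≤ Upay f x s s) ∧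
    (∀ s ∈ Set.Icc L R, ∀ t ∈ Set.Icc L R, Upay f x t s ≤ Upay f x s s)

/-- The designer's value `V(x)`. -/
def Value (f : ℝ → ℝ) (L R : ℝ) {m : ℕ} (x : ℝ → (Fin m → ℝ) → ℝ) : ℝ :=
  2 ^ m * ∫ s in L..R, (s * Amap f x s + (1 - s) * Bmap f x s) * f s

/-- The first-best utility `Ubar`. -/
def Ubar (f : ℝ → ℝ) (m : ℕ) (s : ℝ) : ℝ :=
  2 ^ m * ∫ y in cube m, max (s * wplus f y - (1 - s) * wminus f y) 0

lemma aux_f_meas {f f' : ℝ → ℝ} (hf : Density f f' 0 1) : Measurable f := by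
  have h : f = (Set.Icc (0:ℝ) 1).piecewise f (fun _ => 0) := by
    funext s
    by_cases hs : s ∈ Set.Icc (0:ℝ) 1
    · rw [Set.piecewise_eq_of_mem _ _ _ hs]
    · rw [Set.piecewise_eq_of_notMem _ _ _ hs, hf.zero_outside s hs]
  rw [h]
  refine ContinuousOn.measurable_piecewise (fun s hs => (hf.hderiv s hs).continuousWithinAt)
    continuousOn_const measurableSet_Icc

lemma aux_f_bdd {f f' : ℝ → ℝ} (hf : Density f f' 0 1) : ∃ C : ℝ, 0 ≤ C ∧ ∀ s, f s ≤ C := by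
  have hc : ContinuousOn f (Set.Icc (0:ℝ) 1) := fun s hs => (hf.hderiv s hs).continuousWithinAt
  obtain ⟨C, hC⟩ := isCompact_Icc.exists_bound_of_continuousOn hc
  have h0 : 0 ≤ C := (norm_nonneg _).trans (hC 0 (by simp))
  refine ⟨C, h0, fun s => ?_⟩
  by_cases hs : s ∈ Set.Icc (0:ℝ) 1
  · exact (le_abs_self _).trans (hC s hs)
  · rw [hf.zero_outside s hs]; exact h0

lemma aux_cube_meas (m : ℕ) : MeasurableSet (cube m) :=
  MeasurableSet.univ_pi fun _ => measurableSet_Icc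

lemma aux_cube_fin (m : ℕ) : volume (cube m) < ⊤ := by
  unfold cube
  exact (isCompact_univ_pi fun _ => isCompact_Icc).measure_lt_top

lemma aux_cube_ae (m : ℕ) :
    ∀ᵐ y ∂(volume.restrict (cube m)), y ∈ cube m ∧ ∀ k, y k ∈ Set.Ioo (0:ℝ) 1 := by
  have h : (Set.univ.pi fun _ : Fin m => Set.Ioo (0:ℝ) 1) =ᵐ[volume] cube m := by
    have := Measure.univ_pi_Ioo_ae_eq_Icc (μ := fun _ : Fin m => (volume : Measure ℝ))
      (f := fun _ => 0) (g := fun _ => 1)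
    rw [← Set.pi_univ_Icc] at this
    exact this
  have h1 : ∀ᵐ y ∂(volume.restrict (cube m)), y ∈ (Set.univ.pi fun _ : Fin m => Set.Ioo (0:ℝ) 1) := by
    rw [← Measure.restrict_congr_set h]
    exact ae_restrict_mem (MeasurableSet.univ_pi fun _ => measurableSet_Ioo)
  filter_upwards [h1, ae_restrict_mem (aux_cube_meas m)] with y hy hy2
  exact ⟨hy2, fun k => hy k (Set.mem_univ k)⟩

lemma aux_wplus_meas {f : ℝ → ℝ} (hf : Measurable f) (m : ℕ) :
    Measurable (fun y : Fin m → ℝ => wplus f y) := by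
  unfold wplus
  fun_prop

lemma aux_wminus_meas {f : ℝ → ℝ} (hf : Measurable f) (m : ℕ) :
    Measurable (fun y : Fin m → ℝ => wminus f y) := by
  unfold wminus
  fun_prop

lemma aux_wplus_bd {f : ℝ → ℝ} {C : ℝ} (h0 : ∀ s, 0 ≤ f s) (hC : ∀ s, f s ≤ C) {m : ℕ}
    {y : Fin m → ℝ} (hy : y ∈ cube m) : 0 ≤ wplus f y ∧ wplus f y ≤ C ^ m := by
  have hy' : ∀ k, 0 ≤ y k ∧ y k ≤ 1 := fun k => hy k (Set.mem_univ k)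
  constructor
  · exact Finset.prod_nonneg fun k _ => mul_nonneg (hy' k).1 (h0 _)
  · have := Finset.prod_le_prod (s := Finset.univ) (f := fun k => y k * f (y k)) (g := fun _ => C)
      (fun k _ => mul_nonneg (hy' k).1 (h0 _))
      (fun k _ => (mul_le_of_le_one_left (h0 _) (hy' k).2).trans (hC _))
    simpa [wplus] using this

lemma aux_wminus_bd {f : ℝ → ℝ} {C : ℝ} (h0 : ∀ s, 0 ≤ f s) (hC : ∀ s, f s ≤ C) {m : ℕ}
    {y : Fin m → ℝ} (hy : y ∈ cube m) : 0 ≤ wminus f y ∧ wminus f y ≤ C ^ m := by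
  have hy' : ∀ k, 0 ≤ 1 - y k ∧ 1 - y k ≤ 1 := fun k => by
    have : 0 ≤ y k ∧ y k ≤ 1 := hy k (Set.mem_univ k)
    constructor <;> linarith
  constructor
  · exact Finset.prod_nonneg fun k _ => mul_nonneg (hy' k).1 (h0 _)
  · have := Finset.prod_le_prod (s := Finset.univ) (f := fun k => (1 - y k) * f (y k))
      (g := fun _ => C)
      (fun k _ => mul_nonneg (hy' k).1 (h0 _))
      (fun k _ => (mul_le_of_le_one_left (h0 _) (hy' k).2).trans (hC _))
    simpa [wminus] using this

lemma aux_intA {f f' : ℝ → ℝ} (hf : Density f f' 0 1) {m : ℕ} {x : ℝ → (Fin m → ℝ) → ℝ}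
    (hx : IsMechanism x) (t : ℝ) :
    Integrable (fun y => x t y * wplus f y) (volume.restrict (cube m)) := by
  obtain ⟨C, hC0, hC⟩ := aux_f_bdd hf
  have hm := aux_f_meas hf
  haveI : IsFiniteMeasure (volume.restrict (cube m)) :=
    ⟨by simpa using aux_cube_fin m⟩
  have hxt : Measurable (x t) := hx.1.comp measurable_prodMk_left
  refine Integrable.of_bound (hxt.mul (aux_wplus_meas hm m)).aestronglyMeasurable (C ^ m) ?_
  filter_upwards [aux_cube_ae m] with y hy
  obtain ⟨h1, h2⟩ := aux_wplus_bd hf.nonneg hC hy.1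
  obtain ⟨h3, h4⟩ := hx.2 t y
  rw [Real.norm_of_nonneg (mul_nonneg h3 h1)]
  exact (mul_le_of_le_one_left h1 h4).trans h2

lemma aux_intB {f f' : ℝ → ℝ} (hf : Density f f' 0 1) {m : ℕ} {x : ℝ → (Fin m → ℝ) → ℝ}
    (hx : IsMechanism x) (t : ℝ) :
    Integrable (fun y => x t y * wminus f y) (volume.restrict (cube m)) := by
  obtain ⟨C, hC0, hC⟩ := aux_f_bdd hf
  have hm := aux_f_meas hf
  haveI : IsFiniteMeasure (volume.restrict (cube m)) :=
    ⟨by simpa using aux_cube_fin m⟩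
  have hxt : Measurable (x t) := hx.1.comp measurable_prodMk_left
  refine Integrable.of_bound (hxt.mul (aux_wminus_meas hm m)).aestronglyMeasurable (C ^ m) ?_
  filter_upwards [aux_cube_ae m] with y hy
  obtain ⟨h1, h2⟩ := aux_wminus_bd hf.nonneg hC hy.1
  obtain ⟨h3, h4⟩ := hx.2 t y
  rw [Real.norm_of_nonneg (mul_nonneg h3 h1)]
  exact (mul_le_of_le_one_left h1 h4).trans h2

/-- total weight -/
def auxW (f : ℝ → ℝ) {m : ℕ} (p : ℝ × (Fin m → ℝ)) : ℝ :=
  (p.1 * wplus f p.2 + (1 - p.1) * wminus f p.2) * f p.1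

/-- the restricted product measure -/
def auxmu (m : ℕ) : Measure (ℝ × (Fin m → ℝ)) :=
  (volume.restrict (Set.Icc (0:ℝ) 1)).prod (volume.restrict (cube m))

lemma aux_ae (m : ℕ) : ∀ᵐ p ∂(auxmu m), p.1 ∈ Set.Ioo (0:ℝ) 1 ∧ p.2 ∈ cube m ∧
    ∀ k, p.2 k ∈ Set.Ioo (0:ℝ) 1 := by
  have h1 : ∀ᵐ s ∂(volume.restrict (Set.Icc (0:ℝ) 1)), s ∈ Set.Ioo (0:ℝ) 1 := by
    rw [← Measure.restrict_congr_set Ioo_ae_eq_Icc]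
    exact ae_restrict_mem measurableSet_Ioo
  have h2 := Measure.quasiMeasurePreserving_fst (μ := volume.restrict (Set.Icc (0:ℝ) 1))
    (ν := volume.restrict (cube m)) |>.ae h1
  have h3 := Measure.quasiMeasurePreserving_snd (μ := volume.restrict (Set.Icc (0:ℝ) 1))
    (ν := volume.restrict (cube m)) |>.ae (aux_cube_ae m)
  unfold auxmu
  filter_upwards [h2, h3] with p hp hq
  exact ⟨hp, hq⟩

lemma aux_intW {f f' : ℝ → ℝ} (hf : Density f f' 0 1) {m : ℕ} {x : ℝ → (Fin m → ℝ) → ℝ}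
    (hx : IsMechanism x) :
    Integrable (fun p : ℝ × (Fin m → ℝ) => x p.1 p.2 * auxW f p) (auxmu m) := by
  obtain ⟨C, hC0, hC⟩ := aux_f_bdd hf
  have hm := aux_f_meas hf
  haveI : IsFiniteMeasure (volume.restrict (cube m)) :=
    ⟨by simpa using aux_cube_fin m⟩
  haveI : IsFiniteMeasure (auxmu m) := by unfold auxmu; infer_instance
  have hW : Measurable (fun p : ℝ × (Fin m → ℝ) => auxW f p) := by
    have := aux_wplus_meas hm m
    have := aux_wminus_meas hm m
    unfold auxW
    fun_prop
  have hx1 : Measurable (fun p : ℝ × (Fin m → ℝ) => x p.1 p.2) := hx.1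
  refine Integrable.of_bound (hx1.mul hW).aestronglyMeasurable ((C ^ m) * C) ?_
  filter_upwards [aux_ae m] with p hp
  obtain ⟨⟨hs0, hs1⟩, hy, -⟩ := hp
  obtain ⟨h1, h2⟩ := aux_wminus_bd hf.nonneg hC hy
  obtain ⟨h5, h6⟩ := aux_wplus_bd hf.nonneg hC hy
  obtain ⟨h3, h4⟩ := hx.2 p.1 p.2
  have hs2 : 0 ≤ 1 - p.1 := by linarith
  have hs3 := hs0.le
  have h7 : 0 ≤ p.1 * wplus f p.2 + (1 - p.1) * wminus f p.2 := by positivity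
  have h8 : p.1 * wplus f p.2 + (1 - p.1) * wminus f p.2 ≤ C ^ m := by
    have := mul_le_mul_of_nonneg_left h6 hs3
    have := mul_le_mul_of_nonneg_left h2 hs2
    linarith
  have h9 : 0 ≤ auxW f p := mul_nonneg h7 (hf.nonneg _)
  rw [Real.norm_of_nonneg (mul_nonneg h3 h9)]
  refine (mul_le_of_le_one_left h9 h4).trans ?_
  exact mul_le_mul h8 (hC _) (hf.nonneg _) (by positivity)

lemma aux_value {f f' : ℝ → ℝ} (hf : Density f f' 0 1) {m : ℕ} {x : ℝ → (Fin m → ℝ) → ℝ}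
    (hx : IsMechanism x) :
    Value f 0 1 x = 2 ^ m * ∫ p, x p.1 p.2 * auxW f p ∂(auxmu m) := by
  unfold Value
  congr 1
  have hi := aux_intW hf hx
  unfold auxmu at hi ⊢
  rw [integral_prod _ hi, intervalIntegral.integral_of_le zero_le_one,
    ← integral_Icc_eq_integral_Ioc]
  congr 1
  funext s
  have hA := aux_intA hf hx s
  have hB := aux_intB hf hx s
  unfold Amap Bmap
  rw [← integral_const_mul, ← integral_const_mul,
    ← integral_add (hA.const_mul _) (hB.const_mul _), ← integral_mul_const]
  congr 1
  funext y
  simp only [auxW]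
  ring

lemma aux_wm_pos {f f' : ℝ → ℝ} (hf : Density f f' 0 1) {m : ℕ} {y : Fin m → ℝ}
    (hy : ∀ k, y k ∈ Set.Ioo (0:ℝ) 1) : 0 < wminus f y :=
  Finset.prod_pos fun k _ => mul_pos (by linarith [(hy k).2])
    (hf.pos _ ⟨(hy k).1.le, (hy k).2.le⟩)

lemma aux_wp_pos {f f' : ℝ → ℝ} (hf : Density f f' 0 1) {m : ℕ} {y : Fin m → ℝ}
    (hy : ∀ k, y k ∈ Set.Ioo (0:ℝ) 1) : 0 < wplus f y :=
  Finset.prod_pos fun k _ => mul_pos (hy k).1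
    (hf.pos _ ⟨(hy k).1.le, (hy k).2.le⟩)

lemma aux_W_pos {f f' : ℝ → ℝ} (hf : Density f f' 0 1) {m : ℕ} {p : ℝ × (Fin m → ℝ)}
    (hs : p.1 ∈ Set.Ioo (0:ℝ) 1) (hy : ∀ k, p.2 k ∈ Set.Ioo (0:ℝ) 1) : 0 < auxW f p := by
  have h1 := aux_wm_pos hf hy
  have h2 := aux_wp_pos hf hy
  have h3 := hf.pos p.1 ⟨hs.1.le, hs.2.le⟩
  have h4 := hs.1
  have h5 : 0 < 1 - p.1 := by linarith [hs.2]
  unfold auxW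
  positivity

lemma aux_zero {f f' : ℝ → ℝ} (hf : Density f f' 0 1) {m : ℕ} {x : ℝ → (Fin m → ℝ) → ℝ}
    (hx : IsMechanism x) (hU : 0 ≤ Upay f x 0 0) :
    ∀ᵐ y ∂(volume.restrict (cube m)), x 0 y = 0 := by
  have hB : Bmap f x 0 ≤ 0 := by
    unfold Upay at hU
    have h2 : (0:ℝ) < 2 ^ m := by positivity
    have := nonneg_of_mul_nonneg_right hU h2
    linarith
  have hnn : 0 ≤ᵐ[volume.restrict (cube m)] fun y => x 0 y * wminus f y := by
    filter_upwards [aux_cube_ae m] with y hy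
    exact mul_nonneg (hx.2 0 y).1 (aux_wm_pos hf hy.2).le
  have h0 : ∫ y in cube m, x 0 y * wminus f y = 0 :=
    le_antisymm hB (integral_nonneg_of_ae hnn)
  have := (integral_eq_zero_iff_of_nonneg_ae hnn (aux_intB hf hx 0)).1 h0
  filter_upwards [this, aux_cube_ae m] with y hy hy2
  have h1 : x 0 y * wminus f y = 0 := hy
  exact (mul_eq_zero.1 h1).resolve_right (aux_wm_pos hf hy2.2).ne'

theorem stmt3 (n : ℕ) (hn : 2 ≤ n) (f f' : ℝ → ℝ) (hf : Density f f' 0 1)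
    (xeff : ℝ → (Fin (n - 1) → ℝ) → ℝ)
    (hxeff : ∀ (s : ℝ) (y : Fin (n - 1) → ℝ),
      xeff s y = if (1 - s) * ∏ k, (1 - y k) ≤ s * ∏ k, y k then 1 else 0)
    (EPIC Part : (ℝ → (Fin (n - 1) → ℝ) → ℝ) → Prop)
    (hEPIC : ∀ x : ℝ → (Fin (n - 1) → ℝ) → ℝ, EPIC x ↔
      ∀ s ∈ Set.Icc (0:ℝ) 1, ∀ t ∈ Set.Icc (0:ℝ) 1, ∀ y ∈ cube (n - 1),
        x t y * (s * ∏ k, y k - (1 - s) * ∏ k, (1 - y k)) ≤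
          x s y * (s * ∏ k, y k - (1 - s) * ∏ k, (1 - y k)))
    (hPart : ∀ x : ℝ → (Fin (n - 1) → ℝ) → ℝ, Part x ↔
      ∀ s ∈ Set.Icc (0:ℝ) 1, 0 ≤ Upay f x s s) :
    (EPIC xeff ∧ Part xeff) ∧
    (∀ x : ℝ → (Fin (n - 1) → ℝ) → ℝ, IsMechanism x → EPIC x → Part x →
      Value f 0 1 x ≤ Value f 0 1 xeff) ∧
    (∀ x : ℝ → (Fin (n - 1) → ℝ) → ℝ, IsMechanism x → EPIC x → Part x →
      Value f 0 1 x = Value f 0 1 xeff →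
      ∀ᵐ p ∂(volume.restrict ((Set.Icc (0:ℝ) 1) ×ˢ cube (n - 1))),
        x p.1 p.2 = xeff p.1 p.2) := by
  have hmech : IsMechanism xeff := by
    constructor
    · have : Function.uncurry xeff = fun p : ℝ × (Fin (n - 1) → ℝ) =>
          if (1 - p.1) * ∏ k, (1 - p.2 k) ≤ p.1 * ∏ k, p.2 k then 1 else 0 := by
        funext p
        exact hxeff p.1 p.2
      rw [this]
      refine Measurable.ite (measurableSet_le ?_ ?_) measurable_const measurable_const <;> fun_prop
    · intro s y
      rw [hxeff]
      split_ifs <;> simp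
  have key : ∀ x : ℝ → (Fin (n - 1) → ℝ) → ℝ, IsMechanism x → EPIC x → Part x →
      ∀ᵐ p ∂(auxmu (n - 1)), x p.1 p.2 ≤ xeff p.1 p.2 := by
    intro x hx hE hP
    have hz := aux_zero hf hx ((hPart x).1 hP 0 (by simp))
    have h3 := Measure.quasiMeasurePreserving_snd (μ := volume.restrict (Set.Icc (0:ℝ) 1))
      (ν := volume.restrict (cube (n - 1))) |>.ae hz
    filter_upwards [aux_ae (n - 1), h3] with p hp h0
    obtain ⟨hs, hy, -⟩ := hp
    rw [hxeff]
    split_ifs with hc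
    · exact (hx.2 _ _).2
    · have h := (hEPIC x).1 hE p.1 ⟨hs.1.le, hs.2.le⟩ 0 (by simp) p.2 hy
      rw [h0, zero_mul] at h
      by_contra hlt
      have := mul_neg_of_pos_of_neg (not_le.1 hlt) (sub_neg.2 (not_le.1 hc))
      linarith
  have hmono : ∀ x : ℝ → (Fin (n - 1) → ℝ) → ℝ, IsMechanism x → EPIC x → Part x →
      (fun p : ℝ × (Fin (n - 1) → ℝ) => x p.1 p.2 * auxW f p) ≤ᵐ[auxmu (n - 1)]
        fun p => xeff p.1 p.2 * auxW f p := by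
    intro x hx hE hP
    filter_upwards [aux_ae (n - 1), key x hx hE hP] with p hp hle
    exact mul_le_mul_of_nonneg_right hle (aux_W_pos hf hp.1 hp.2.2).le
  refine ⟨⟨?_, ?_⟩, ?_, ?_⟩
  · rw [hEPIC]
    intro s hs t ht y hy
    rw [hxeff s y]
    obtain ⟨h0, h1⟩ := hmech.2 t y
    split_ifs with hc
    · exact mul_le_mul_of_nonneg_right h1 (sub_nonneg.2 hc)
    · rw [zero_mul]
      exact mul_nonpos_of_nonneg_of_nonpos h0 (sub_neg.2 (not_le.1 hc)).le
  · rw [hPart]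
    intro s hs
    unfold Upay Amap Bmap
    have hA := aux_intA hf hmech s
    have hB := aux_intB hf hmech s
    refine mul_nonneg (by positivity) ?_
    rw [← integral_const_mul, ← integral_const_mul,
      ← integral_sub (hA.const_mul _) (hB.const_mul _)]
    refine integral_nonneg fun y => ?_
    have hF : 0 ≤ ∏ k, f (y k) := Finset.prod_nonneg fun k _ => hf.nonneg _
    have e : s * (xeff s y * wplus f y) - (1 - s) * (xeff s y * wminus f y) =
        xeff s y * (s * ∏ k, y k - (1 - s) * ∏ k, (1 - y k)) * ∏ k, f (y k) := by
      unfold wplus wminus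
      rw [Finset.prod_mul_distrib, Finset.prod_mul_distrib]
      ring
    show 0 ≤ s * (xeff s y * wplus f y) - (1 - s) * (xeff s y * wminus f y)
    rw [e]
    refine mul_nonneg ?_ hF
    rw [hxeff]
    split_ifs with hc
    · rw [one_mul]
      exact sub_nonneg.2 hc
    · simp
  · intro x hx hE hP
    rw [aux_value hf hx, aux_value hf hmech]
    exact mul_le_mul_of_nonneg_left
      (integral_mono_ae (aux_intW hf hx) (aux_intW hf hmech) (hmono x hx hE hP)) (by positivity)
  · intro x hx hE hP hV
    rw [aux_value hf hx, aux_value hf hmech] at hV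
    have hV' := mul_left_cancel₀ (by positivity) hV
    have hae := (integral_eq_iff_of_ae_le (aux_intW hf hx) (aux_intW hf hmech)
      (hmono x hx hE hP)).1 hV'
    have hmu : (volume.restrict ((Set.Icc (0:ℝ) 1) ×ˢ cube (n - 1)) :
        Measure (ℝ × (Fin (n - 1) → ℝ))) = auxmu (n - 1) := by
      unfold auxmu
      rw [Measure.prod_restrict]
      rfl
    rw [hmu]
    filter_upwards [hae, aux_ae (n - 1)] with p hp hq
    exact mul_right_cancel₀ (aux_W_pos hf hq.1 hq.2.2).ne' hp
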